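/- For all integers n ≥ 2, the number B_n of complete non-ambiguous trees of size n with determinant −1 satisfies the recurrence B_n = Σ_{k=1}^{n-1} [ (A_k·B_{n-k} + B_k·A_{n-k})·(e^{n-1}_{k-1}·e^{n-1}_k + o^{n-1}_{k-1}·o^{n-1}_k) + (A_k·A_{n-k} + B_k·B_{n-k})·(e^{n-1}_{k-1}·o^{n-1}_k + o^{n-1}_{k-1}·e^{n-1}_k) ]. -/

import Mathlib

/-- A complete non-ambiguous tree (CNAT) of size `n`: a dotted filling of the
`n × n` grid (`dot i j = true` means cell in row `i`, column `j` is dotted)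
such that the top-left cell (the root) is dotted; every other dotted cell
(vertex) has another vertex either above it in the same column, or to its left
in the same row, but not both; every row and column contains a vertex; and the
underlying rooted binary tree is complete, i.e. every vertex has either both a
child below it in its column and a child to its right in its row, or neither. -/
structure CNAT (n : ℕ) where
  dot : Fin n → Fin n → Bool
  root : ∀ h : 0 < n, dot ⟨0, h⟩ ⟨0, h⟩ = true
  nonambiguous : ∀ i j : Fin n, dot i j = true → ¬((i : ℕ) = 0 ∧ (j : ℕ) = 0) →
    Xor' (∃ i' : Fin n, i' < i ∧ dot i' j = true)
         (∃ j' : Fin n, j' < j ∧ dot i j' = true)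
  min_row : ∀ i : Fin n, ∃ j : Fin n, dot i j = true
  min_col : ∀ j : Fin n, ∃ i : Fin n, dot i j = true
  complete : ∀ i j : Fin n, dot i j = true →
    ((∃ i' : Fin n, i < i' ∧ dot i' j = true) ↔ (∃ j' : Fin n, j < j' ∧ dot i j' = true))

/-- The determinant of a CNAT viewed as a 0-1 matrix. -/
noncomputable def cnatDet {n : ℕ} (M : CNAT n) : ℤ :=
  Matrix.det (Matrix.of fun i j => if M.dot i j then (1 : ℤ) else 0)

/-- `cnatA n` is the number of CNATs of size `n` with determinant `1`. -/
noncomputable def cnatA (n : ℕ) : ℕ := Nat.card {M : CNAT n // cnatDet M = 1}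

/-- `cnatB n` is the number of CNATs of size `n` with determinant `-1`. -/
noncomputable def cnatB (n : ℕ) : ℕ := Nat.card {M : CNAT n // cnatDet M = -1}

/-- `cnatT n = cnatA n + cnatB n` is the total number of CNATs of size `n`. -/
noncomputable def cnatT (n : ℕ) : ℕ := cnatA n + cnatB n

/-- The defect `D n = A n - B n`. -/
noncomputable def cnatD (n : ℕ) : ℤ := (cnatA n : ℤ) - (cnatB n : ℤ)

/-- `eCount m k` is the number of `k`-element subsets of `{1, …, m}` with even sum. -/
def eCount (m k : ℕ) : ℕ :=
  ((Finset.powersetCard k (Finset.Icc 1 m)).filter fun S => Even (S.sum id)).card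

/-- `oCount m k` is the number of `k`-element subsets of `{1, …, m}` with odd sum. -/
def oCount (m k : ℕ) : ℕ :=
  ((Finset.powersetCard k (Finset.Icc 1 m)).filter fun S => Odd (S.sum id)).card

structure MonoSum {k l n : ℕ} (e : Fin k ⊕ Fin l ≃ Fin n) : Prop where
  left : StrictMono fun a => e (Sum.inl a)
  right : StrictMono fun a => e (Sum.inr a)

lemma exists_adj {k l n : ℕ} (e : Fin k ⊕ Fin l ≃ Fin n) : ∀ (x : ℕ) (a : Fin k) (b : Fin l),
    (e (Sum.inl a)).val = x → e (Sum.inr b) < e (Sum.inl a) →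
    ∃ a' b', (e (Sum.inl a')).val = (e (Sum.inr b')).val + 1 := by
  intro x
  induction x with
  | zero => intro a b h1 h2; exfalso; have := Fin.lt_def.1 h2; omega
  | succ x ih =>
    intro a b h1 h2
    have h2' := Fin.lt_def.1 h2
    have hx : x < n := by have := (e (Sum.inl a)).2; omega
    rcases hc : e.symm ⟨x, hx⟩ with c | c
    · have hc' : e (Sum.inl c) = ⟨x, hx⟩ := by rw [← hc]; simp
      refine ih c b (by rw [hc']) ?_
      rw [Fin.lt_def, hc']
      have : (e (Sum.inr b)) ≠ e (Sum.inl c) := by intro h; have := e.injective h; simp at this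
      rw [hc'] at this
      have : (e (Sum.inr b)).val ≠ x := fun h => this (Fin.ext h)
      simp only
      omega
    · have hc' : e (Sum.inr c) = ⟨x, hx⟩ := by rw [← hc]; simp
      exact ⟨a, c, by rw [hc', h1]⟩

lemma swap_adj_mono {ι : Type*} [Preorder ι] {n : ℕ} (x y : Fin n) (hxy : y.val = x.val + 1)
    (f : ι → Fin n) (hf : StrictMono f) (h : (∀ i, f i ≠ x) ∨ (∀ i, f i ≠ y)) :
    StrictMono fun i => Equiv.swap x y (f i) := by
  intro i j hij
  have h1 := hf hij
  simp only [Equiv.swap_apply_def]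
  rcases h with h | h <;> have hi := h i <;> have hj := h j <;>
  split_ifs <;> simp only [Fin.lt_def, Fin.ext_iff, ne_eq] at * <;> omega

lemma sgn_base {k l : ℕ} : ∀ (N : ℕ) (e : Fin k ⊕ Fin l ≃ Fin (k + l)), MonoSum e →
    ∑ a, (e (Sum.inl a)).val = N →
    Equiv.Perm.sign (finSumFinEquiv.symm.trans e) * (-1) ^ N = (-1) ^ (∑ a : Fin k, a.val) := by
  intro N
  induction N with
  | zero => ?_
  | succ N ih => ?_
  all_goals
    intro e he hN
    by_cases hadj : ∃ a' b', (e (Sum.inl a')).val = (e (Sum.inr b')).val + 1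
  · obtain ⟨a, b, hab⟩ := hadj
    have := Finset.single_le_sum (f := fun a => (e (Sum.inl a)).val) (fun i _ => Nat.zero_le _) (Finset.mem_univ a)
    omega
  case pos =>
    obtain ⟨a, b, hab⟩ := hadj
    set σ := Equiv.swap (e (Sum.inr b)) (e (Sum.inl a)) with hσ
    have hm : MonoSum (e.trans σ) := ⟨swap_adj_mono _ _ hab _ he.left (Or.inl (by simp)),
      swap_adj_mono _ _ hab _ he.right (Or.inr (by simp))⟩
    have hs : ∑ a', ((e.trans σ) (Sum.inl a')).val = N := by
      rw [← Finset.add_sum_erase _ _ (Finset.mem_univ a)] at hN ⊢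
      have : ∑ x ∈ Finset.univ.erase a, ((e.trans σ) (Sum.inl x)).val = ∑ x ∈ Finset.univ.erase a, (e (Sum.inl x)).val := by
        apply Finset.sum_congr rfl
        intro x hx
        have : x ≠ a := Finset.ne_of_mem_erase hx
        simp only [Equiv.trans_apply, hσ]
        rw [Equiv.swap_apply_of_ne_of_ne] <;> simp [this]
      rw [this]
      simp only [Equiv.trans_apply, hσ, Equiv.swap_apply_right]
      omega
    have := ih _ hm hs
    rw [← this]
    have h2 : finSumFinEquiv.symm.trans (e.trans σ) = σ * (finSumFinEquiv.symm.trans e) := by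
      ext; simp
    rw [h2, Equiv.Perm.sign_mul, hσ, Equiv.Perm.sign_swap (by simp)]
    rw [pow_succ]; simp
  all_goals
    have hlt : ∀ a b, e (Sum.inl a) < e (Sum.inr b) := by
      intro a b
      by_contra h
      rcases lt_or_eq_of_le (not_lt.1 h) with h | h
      · exact hadj (exists_adj e _ a b rfl h)
      · have := e.injective h; simp at this
    have hmono : StrictMono (finSumFinEquiv.symm.trans e) := by
      intro x y hxy
      obtain ⟨x, rfl⟩ := finSumFinEquiv.surjective x
      obtain ⟨y, rfl⟩ := finSumFinEquiv.surjective y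
      simp only [Equiv.trans_apply, Equiv.symm_apply_apply]
      rcases x with x | x <;> rcases y with y | y
      · exact he.left (by simp at hxy; exact hxy)
      · exact hlt _ _
      · exfalso; simp [Fin.lt_def] at hxy; omega
      · exact he.right (by simpa using hxy)
    have hid : finSumFinEquiv.symm.trans e = Equiv.refl _ := by
      apply Equiv.ext
      intro x
      have := (StrictMono.range_inj hmono (strictMono_id)).1 (by
        rw [(finSumFinEquiv.symm.trans e).surjective.range_eq]; simp)
      exact congrFun this x
    have h3 : ∀ a, (e (Sum.inl a)).val = a.val := by
      intro a
      have := congrArg (fun f => (f (finSumFinEquiv (Sum.inl a))).val) hid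
      simpa using this
    rw [hid, ← hN]
    simp [h3, Equiv.Perm.sign_refl]

lemma sgn_lem {k l n : ℕ} (e f : Fin k ⊕ Fin l ≃ Fin n) (he : MonoSum e) (hf : MonoSum f) :
    Equiv.Perm.sign (e.symm.trans f) =
      (-1) ^ (∑ a, (e (Sum.inl a)).val + ∑ a, (f (Sum.inl a)).val) := by
  have hn : n = k + l := by simpa using (Fintype.card_congr e).symm
  subst hn
  have h1 := sgn_base _ e he rfl
  have h2 := sgn_base _ f hf rfl
  have h3 : e.symm.trans f = (finSumFinEquiv.symm.trans f) * (finSumFinEquiv.symm.trans e)⁻¹ := by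
    ext; simp [Equiv.Perm.inv_def]
  rw [h3, Equiv.Perm.sign_mul, Equiv.Perm.sign_inv]
  rw [pow_add]
  rw [← h2] at h1
  set u := Equiv.Perm.sign (finSumFinEquiv.symm.trans e)
  set v := Equiv.Perm.sign (finSumFinEquiv.symm.trans f)
  have p1 : ∀ m : ℕ, ((-1 : ℤˣ) ^ m) * (-1) ^ m = 1 := fun m => by rw [← mul_pow]; simp
  have p2 : u * u = 1 := Int.units_mul_self u
  calc v * u = (v * (-1) ^ (∑ a, (f (Sum.inl a)).val)) * (-1) ^ (∑ a, (f (Sum.inl a)).val) * u := by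
        rw [mul_assoc v, p1, mul_one]
    _ = (u * u) * (-1) ^ (∑ a, (e (Sum.inl a)).val) * (-1) ^ (∑ a, (f (Sum.inl a)).val) := by
        rw [← h1]; simp only [mul_comm, mul_left_comm]
    _ = _ := by rw [p2, one_mul]

lemma det_blocks {k l n : ℕ} (e f : Fin k ⊕ Fin l ≃ Fin n) (he : MonoSum e) (hf : MonoSum f)
    (M : Matrix (Fin n) (Fin n) ℤ) (h0 : ∀ a b, M (e (Sum.inl a)) (f (Sum.inr b)) = 0) :
    M.det = (-1) ^ (∑ a, (e (Sum.inl a)).val + ∑ a, (f (Sum.inl a)).val) *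
      ((M.submatrix (fun a => e (Sum.inl a)) (fun b => f (Sum.inl b))).det *
       (M.submatrix (fun a => e (Sum.inr a)) (fun b => f (Sum.inr b))).det) := by
  have h1 : M.submatrix e f = Matrix.fromBlocks
      (M.submatrix (fun a => e (Sum.inl a)) (fun b => f (Sum.inl b))) 0
      (M.submatrix (fun a => e (Sum.inr a)) (fun b => f (Sum.inl b)))
      (M.submatrix (fun a => e (Sum.inr a)) (fun b => f (Sum.inr b))) := by
    ext a b
    rcases a with a | a <;> rcases b with b | b <;> simp [h0]
  have h2 : M.submatrix e f = (M.submatrix id (e.symm.trans f)).submatrix e e := by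
    ext a b; simp
  have h3 := congrArg Matrix.det h1
  rw [Matrix.det_fromBlocks_zero₁₂, h2, Matrix.det_submatrix_equiv_self, Matrix.det_permute',
    sgn_lem e f he hf] at h3
  rw [← h3, ← mul_assoc]
  push_cast
  rw [← mul_pow]; simp

structure IsC {n : ℕ} (dot : Fin n → Fin n → Bool) : Prop where
  root : ∀ h : 0 < n, dot ⟨0, h⟩ ⟨0, h⟩ = true
  nonambiguous : ∀ i j : Fin n, dot i j = true → ¬((i : ℕ) = 0 ∧ (j : ℕ) = 0) →
    Xor (∃ i' : Fin n, i' < i ∧ dot i' j = true)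
         (∃ j' : Fin n, j' < j ∧ dot i j' = true)
  min_row : ∀ i : Fin n, ∃ j : Fin n, dot i j = true
  min_col : ∀ j : Fin n, ∃ i : Fin n, dot i j = true
  complete : ∀ i j : Fin n, dot i j = true →
    ((∃ i' : Fin n, i < i' ∧ dot i' j = true) ↔ (∃ j' : Fin n, j < j' ∧ dot i j' = true))

structure Glue {k l n : ℕ} (e f : Fin k ⊕ Fin l ≃ Fin n) (M : Fin n → Fin n → Bool)
    (L : Fin k → Fin k → Bool) (R : Fin l → Fin l → Bool) : Prop where
  he : MonoSum e
  hf : MonoSum f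
  e0 : ∀ a, (e (Sum.inl a)).val ≠ 0
  e1 : ∀ a, (e (Sum.inr a)).val = 0 ↔ a.val = 0
  f0 : ∀ a, (f (Sum.inr a)).val ≠ 0
  f1 : ∀ a, (f (Sum.inl a)).val = 0 ↔ a.val = 0
  ll : ∀ a b, M (e (Sum.inl a)) (f (Sum.inl b)) = L a b
  rr : ∀ a b, M (e (Sum.inr a)) (f (Sum.inr b)) = R a b
  lr : ∀ a b, M (e (Sum.inl a)) (f (Sum.inr b)) = false
  rl : ∀ a b, M (e (Sum.inr a)) (f (Sum.inl b)) = true ↔ a.val = 0 ∧ b.val = 0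

section
variable {k l n : ℕ} {e f : Fin k ⊕ Fin l ≃ Fin n} {M : Fin n → Fin n → Bool}
    {L : Fin k → Fin k → Bool} {R : Fin l → Fin l → Bool}

lemma Glue.transpose (g : Glue e f M L R) :
    Glue ((Equiv.sumComm _ _).trans f) ((Equiv.sumComm _ _).trans e) (fun i j => M j i)
      (fun i j => R j i) (fun i j => L j i) where
  he := ⟨g.hf.right, g.hf.left⟩
  hf := ⟨g.he.right, g.he.left⟩
  e0 := g.f0
  e1 := g.f1
  f0 := g.e0
  f1 := g.e1
  ll := fun a b => g.rr b a
  rr := fun a b => g.ll b a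
  lr := fun a b => g.lr b a
  rl := fun a b => by simpa [and_comm] using g.rl b a

lemma IsC.transpose {n : ℕ} {M : Fin n → Fin n → Bool} (h : IsC M) : IsC (fun i j => M j i) where
  root := h.root
  nonambiguous := fun i j hd hr => by
    have := h.nonambiguous j i hd (by tauto)
    rwa [xor_comm] at this
  min_row := h.min_col
  min_col := h.min_row
  complete := fun i j hd => (h.complete j i hd).symm

lemma Glue.above (g : Glue e f M L R) (a b : Fin k) :
    (∃ i', i' < e (Sum.inl a) ∧ M i' (f (Sum.inl b)) = true) ↔
      (∃ a', a' < a ∧ L a' b = true) ∨ (0 < l ∧ b.val = 0) := by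
  rw [e.surjective.exists]
  simp only [Sum.exists, g.ll, g.rl]
  have : ∀ a', e (Sum.inl a') < e (Sum.inl a) ↔ a' < a := fun a' => g.he.left.lt_iff_lt
  simp only [this]
  apply or_congr Iff.rfl
  constructor
  · rintro ⟨b', h1, h2, h3⟩
    exact ⟨by have := b'.2; omega, h3⟩
  · rintro ⟨h1, h2⟩
    refine ⟨⟨0, h1⟩, ?_, rfl, h2⟩
    have := (g.e1 ⟨0, h1⟩).2 rfl
    have := g.e0 a
    rw [Fin.lt_def]; omega

lemma Glue.below (g : Glue e f M L R) (a b : Fin k) :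
    (∃ i', e (Sum.inl a) < i' ∧ M i' (f (Sum.inl b)) = true) ↔
      (∃ a', a < a' ∧ L a' b = true) := by
  rw [e.surjective.exists]
  simp only [Sum.exists, g.ll, g.rl]
  have : ∀ a', e (Sum.inl a) < e (Sum.inl a') ↔ a < a' := fun a' => g.he.left.lt_iff_lt
  simp only [this]
  constructor
  · rintro (h | ⟨b', h1, h2, h3⟩)
    · exact h
    · have := (g.e1 b').2 h2
      rw [Fin.lt_def] at h1; omega
  · exact Or.inl

lemma Glue.leftOf (g : Glue e f M L R) (a b : Fin k) :
    (∃ j', j' < f (Sum.inl b) ∧ M (e (Sum.inl a)) j' = true) ↔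
      (∃ b', b' < b ∧ L a b' = true) := by
  rw [f.surjective.exists]
  have : ∀ a', f (Sum.inl a') < f (Sum.inl b) ↔ a' < b := fun a' => g.hf.left.lt_iff_lt
  simp [Sum.exists, g.ll, g.lr, this]

lemma Glue.rightOf (g : Glue e f M L R) (a b : Fin k) :
    (∃ j', f (Sum.inl b) < j' ∧ M (e (Sum.inl a)) j' = true) ↔
      (∃ b', b < b' ∧ L a b' = true) := by
  rw [f.surjective.exists]
  have : ∀ a', f (Sum.inl b) < f (Sum.inl a') ↔ b < a' := fun a' => g.hf.left.lt_iff_lt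
  simp [Sum.exists, g.ll, g.lr, this]

lemma Glue.rootL (g : Glue e f M L R) (hM : IsC M) : ∀ h : 0 < k, L ⟨0, h⟩ ⟨0, h⟩ = true := by
  intro h
  obtain ⟨j, hj⟩ := hM.min_row (e (Sum.inl ⟨0, h⟩))
  induction hN : j.val using Nat.strong_induction_on generalizing j with
  | _ N ih =>
    subst hN
    obtain ⟨j, rfl⟩ := f.surjective j
    rcases j with b | b
    · have h1 := hM.nonambiguous _ _ hj (fun hh => g.e0 _ hh.1)
      by_cases h2 : ∃ j', j' < f (Sum.inl b) ∧ M (e (Sum.inl ⟨0, h⟩)) j' = true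
      · obtain ⟨j', h3, h4⟩ := h2
        exact ih j' h3 j' h4 rfl
      · have h3 : ∃ i', i' < e (Sum.inl ⟨0, h⟩) ∧ M i' (f (Sum.inl b)) = true := by
          rcases h1 with h1 | h1
          · exact h1.1
          · exact absurd h1.1 h2
        rw [g.above] at h3
        rcases h3 with ⟨a', h3, _⟩ | ⟨_, h3⟩
        · exact absurd h3 (by simp [Fin.lt_def])
        · rw [g.ll] at hj
          have : b = ⟨0, h⟩ := Fin.ext h3
          rwa [this] at hj
    · simp [g.lr] at hj

lemma Glue.above' (g : Glue e f M L R) (hl : 0 < l) (h0 : ∀ h : 0 < k, L ⟨0, h⟩ ⟨0, h⟩ = true)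
    (a b : Fin k) :
    (∃ i', i' < e (Sum.inl a) ∧ M i' (f (Sum.inl b)) = true) ↔
      (∃ a', a' < a ∧ L a' b = true) ∨ (a.val = 0 ∧ b.val = 0) := by
  rw [g.above]
  constructor
  · rintro (h | ⟨_, h⟩)
    · exact Or.inl h
    · by_cases ha : a.val = 0
      · exact Or.inr ⟨ha, h⟩
      · left
        have hk : 0 < k := by have := a.2; omega
        refine ⟨⟨0, hk⟩, by rw [Fin.lt_def]; simp only; omega, ?_⟩
        have hb : b = ⟨0, hk⟩ := Fin.ext h
        rw [hb]; exact h0 hk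
  · rintro (h | h)
    · exact Or.inl h
    · exact Or.inr ⟨hl, h.2⟩

lemma Glue.isC_left (g : Glue e f M L R) (hl : 0 < l) (hM : IsC M) : IsC L where
  root := g.rootL hM
  nonambiguous := fun a b hd hr => by
    have h1 := hM.nonambiguous (e (Sum.inl a)) (f (Sum.inl b)) (by rwa [g.ll])
      (fun hh => g.e0 _ hh.1)
    rw [g.above' hl (g.rootL hM), g.leftOf] at h1
    simpa [hr] using h1
  min_row := fun a => by
    obtain ⟨j, hj⟩ := hM.min_row (e (Sum.inl a))
    obtain ⟨j, rfl⟩ := f.surjective j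
    rcases j with b | b
    · exact ⟨b, by rwa [g.ll] at hj⟩
    · simp [g.lr] at hj
  min_col := fun b => by
    obtain ⟨i, hi⟩ := hM.min_col (f (Sum.inl b))
    obtain ⟨i, rfl⟩ := e.surjective i
    rcases i with a | a
    · exact ⟨a, by rwa [g.ll] at hi⟩
    · rw [g.rl] at hi
      have hk : 0 < k := by have := b.2; omega
      refine ⟨⟨0, hk⟩, ?_⟩
      have hb : b = ⟨0, hk⟩ := Fin.ext hi.2
      rw [hb]; exact g.rootL hM hk
  complete := fun a b hd => by
    have h1 := hM.complete (e (Sum.inl a)) (f (Sum.inl b)) (by rwa [g.ll])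
    rwa [g.below, g.rightOf] at h1

lemma Glue.isC_right (g : Glue e f M L R) (hk : 0 < k) (hM : IsC M) : IsC R :=
  (g.transpose.isC_left hk hM.transpose).transpose

lemma Glue.na_left (g : Glue e f M L R) (hl : 0 < l) (hL : IsC L) (a b : Fin k)
    (hd : M (e (Sum.inl a)) (f (Sum.inl b)) = true) :
    Xor (∃ i', i' < (e (Sum.inl a)) ∧ M i' (f (Sum.inl b)) = true)
      (∃ j', j' < (f (Sum.inl b)) ∧ M (e (Sum.inl a)) j' = true) := by
  rw [g.ll] at hd
  rw [g.above' hl hL.root, g.leftOf]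
  by_cases hr : a.val = 0 ∧ b.val = 0
  · left
    refine ⟨Or.inr hr, ?_⟩
    rintro ⟨b', h, _⟩
    rw [Fin.lt_def] at h; omega
  · simpa [hr] using hL.nonambiguous a b hd hr

lemma Glue.complete_left (g : Glue e f M L R) (hL : IsC L) (a b : Fin k)
    (hd : M (e (Sum.inl a)) (f (Sum.inl b)) = true) :
    (∃ i', (e (Sum.inl a)) < i' ∧ M i' (f (Sum.inl b)) = true) ↔
      (∃ j', (f (Sum.inl b)) < j' ∧ M (e (Sum.inl a)) j' = true) := by
  rw [g.ll] at hd
  rw [g.below, g.rightOf]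
  exact hL.complete a b hd

lemma Glue.isC (g : Glue e f M L R) (hk : 0 < k) (hl : 0 < l) (hL : IsC L) (hR : IsC R) :
    IsC M where
  root := fun h => by
    have h1 : e (Sum.inr ⟨0, hl⟩) = ⟨0, h⟩ := Fin.ext ((g.e1 _).2 rfl)
    have h2 : f (Sum.inl ⟨0, hk⟩) = ⟨0, h⟩ := Fin.ext ((g.f1 _).2 rfl)
    have := (g.rl ⟨0, hl⟩ ⟨0, hk⟩).2 ⟨rfl, rfl⟩
    rwa [h1, h2] at this
  nonambiguous := fun i j => by
    obtain ⟨i, rfl⟩ := e.surjective i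
    obtain ⟨j, rfl⟩ := f.surjective j
    rcases i with a | a <;> rcases j with b | b <;> intro hd hr
    · exact g.na_left hl hL a b hd
    · simp [g.lr] at hd
    · rw [g.rl, ← g.e1, ← g.f1] at hd; exact absurd hd hr
    · rw [xor_comm]; exact g.transpose.na_left hk hR.transpose b a hd
  min_row := fun i => by
    obtain ⟨i, rfl⟩ := e.surjective i
    rcases i with a | a
    · obtain ⟨b, hb⟩ := hL.min_row a
      exact ⟨_, by rw [g.ll]; exact hb⟩
    · obtain ⟨b, hb⟩ := hR.min_row a
      exact ⟨_, by rw [g.rr]; exact hb⟩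
  min_col := fun j => by
    obtain ⟨j, rfl⟩ := f.surjective j
    rcases j with a | a
    · obtain ⟨b, hb⟩ := hL.min_col a
      exact ⟨_, by rw [g.ll]; exact hb⟩
    · obtain ⟨b, hb⟩ := hR.min_col a
      exact ⟨_, by rw [g.rr]; exact hb⟩
  complete := fun i j => by
    obtain ⟨i, rfl⟩ := e.surjective i
    obtain ⟨j, rfl⟩ := f.surjective j
    rcases i with a | a <;> rcases j with b | b <;> intro hd
    · exact g.complete_left hL a b hd
    · simp [g.lr] at hd
    · rw [g.rl] at hd
      have ha : a = ⟨0, hl⟩ := Fin.ext hd.1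
      have hb : b = ⟨0, hk⟩ := Fin.ext hd.2
      subst ha hb
      have h1 := (g.e1 ⟨0, hl⟩).2 rfl
      have h2 := (g.f1 ⟨0, hk⟩).2 rfl
      apply iff_of_true
      · refine ⟨e (Sum.inl ⟨0, hk⟩), ?_, by rw [g.ll]; exact hL.root hk⟩
        have := g.e0 ⟨0, hk⟩
        rw [Fin.lt_def]; omega
      · refine ⟨f (Sum.inr ⟨0, hl⟩), ?_, by rw [g.rr]; exact hR.root hl⟩
        have := g.f0 ⟨0, hl⟩
        rw [Fin.lt_def]; omega
    · exact (g.transpose.complete_left hR.transpose b a hd).symm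
end

structure Valid {n : ℕ} (M : Fin n → Fin n → Bool) (S T : Finset (Fin n)) : Prop where
  s0 : ∀ i ∈ S, i.val ≠ 0
  t0 : ∀ j : Fin n, j.val = 0 → j ∈ T
  col : ∀ i j, M i j = true → ¬(i.val = 0 ∧ j.val = 0) → (i ∈ S ↔ j ∈ T)

lemma exists_leftmost {n : ℕ} {M : Fin n → Fin n → Bool} (hM : IsC M) (i : Fin n) :
    ∃ j, M i j = true ∧ ∀ j', M i j' = true → j ≤ j' := by
  obtain ⟨j, hj⟩ := hM.min_row i
  obtain ⟨m, hm, h⟩ := (Finset.univ.filter (fun j => M i j = true)).exists_minimal ⟨j, by simpa using hj⟩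
  simp only [Finset.mem_filter, Finset.mem_univ, true_and] at hm h
  exact ⟨m, hm, fun j' hj' => by
    rcases le_total m j' with hh | hh
    · exact hh
    · exact h hj' hh⟩

lemma exists_rightmost {n : ℕ} {M : Fin n → Fin n → Bool} (hM : IsC M) (i : Fin n) :
    ∃ j, M i j = true ∧ ∀ j', M i j' = true → j' ≤ j := by
  obtain ⟨j, hj⟩ := hM.min_row i
  obtain ⟨m, hm, h⟩ := (Finset.univ.filter (fun j => M i j = true)).exists_maximal ⟨j, by simpa using hj⟩
  simp only [Finset.mem_filter, Finset.mem_univ, true_and] at hm h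
  exact ⟨m, hm, fun j' hj' => by
    rcases le_total j' m with hh | hh
    · exact hh
    · exact h hj' hh⟩

lemma leftmost_above {n : ℕ} {M : Fin n → Fin n → Bool} (hM : IsC M) {i j : Fin n}
    (hd : M i j = true) (hj : ∀ j', M i j' = true → j ≤ j') (hi : i.val ≠ 0) :
    ∃ i' < i, M i' j = true := by
  rcases hM.nonambiguous i j hd (fun h => hi h.1) with h | h
  · exact h.1
  · obtain ⟨⟨j', h1, h2⟩, _⟩ := h
    exact absurd (hj j' h2) (not_le.2 h1)

lemma exists_valid {n : ℕ} {M : Fin n → Fin n → Bool} (hM : IsC M) : ∃ S T, Valid M S T := by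
  classical
  choose l hl hl' using exists_leftmost hM
  choose t ht ht' using exists_leftmost hM.transpose
  have hlt : ∀ i : Fin n, i.val ≠ 0 → t (l i) < i := by
    intro i hi
    obtain ⟨i', h1, h2⟩ := leftmost_above hM (hl i) (hl' i) hi
    exact lt_of_le_of_lt (ht' _ _ h2) h1
  obtain ⟨R, hR⟩ : ∃ R : Fin n → Prop, ∀ i, R i ↔ i.val ≠ 0 ∧ ((l i).val = 0 ∨ R (t (l i))) := by
    refine ⟨(wellFounded_lt (α := Fin n)).fix (fun i F =>
      ∃ h : i.val ≠ 0, ((l i).val = 0 ∨ F (t (l i)) (hlt i h))), fun i => ?_⟩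
    rw [WellFounded.fix_eq, exists_prop]
  refine ⟨Finset.univ.filter R, Finset.univ.filter (fun j => j.val = 0 ∨ R (t j)), ?_, ?_, ?_⟩
  · intro i hi
    simp only [Finset.mem_filter, Finset.mem_univ, true_and] at hi
    exact ((hR i).1 hi).1
  · intro j hj; simp [hj]
  · intro i j hd hr
    simp only [Finset.mem_filter, Finset.mem_univ, true_and]
    have key := hM.nonambiguous i j hd hr
    by_cases h1 : ∃ j' < j, M i j' = true
    · have h2 : ¬ ∃ i' < i, M i' j = true := by
        rcases key with h | h
        · exact absurd h1 h.2
        · exact h.2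
      have h3 : t j = i := le_antisymm (ht' j i hd) (by
        by_contra h4; exact h2 ⟨t j, not_le.1 h4, ht j⟩)
      have h4 : j.val ≠ 0 := by
        obtain ⟨j', h, _⟩ := h1
        rw [Fin.lt_def] at h; omega
      rw [h3]; tauto
    · have h2 : ∃ i' < i, M i' j = true := by
        rcases key with h | h
        · exact h.1
        · exact absurd h.1 h1
      have h3 : l i = j := le_antisymm (hl' i j hd) (by
        by_contra h4; exact h1 ⟨l i, not_le.1 h4, hl i⟩)
      have h4 : i.val ≠ 0 := by
        obtain ⟨j', h, _⟩ := h2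
        rw [Fin.lt_def] at h; omega
      rw [hR, h3]; tauto

lemma valid_unique {n : ℕ} {M : Fin n → Fin n → Bool} (hM : IsC M) {S T S' T' : Finset (Fin n)}
    (h : Valid M S T) (h' : Valid M S' T') : S = S' ∧ T = T' := by
  have hS : ∀ N : ℕ, ∀ i : Fin n, i.val = N → (i ∈ S ↔ i ∈ S') := by
    intro N
    induction N using Nat.strong_induction_on with
    | _ N ih =>
      intro i hi
      by_cases h0 : i.val = 0
      · exact iff_of_false (fun hh => h.s0 _ hh h0) (fun hh => h'.s0 _ hh h0)
      · obtain ⟨j, hj, hj'⟩ := exists_leftmost hM i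
        obtain ⟨i', hi', hd⟩ := leftmost_above hM hj hj' h0
        rw [h.col i j hj (by tauto), h'.col i j hj (by tauto)]
        by_cases hj0 : j.val = 0
        · exact iff_of_true (h.t0 _ hj0) (h'.t0 _ hj0)
        · rw [← h.col i' j hd (by tauto), ← h'.col i' j hd (by tauto)]
          exact ih i'.val (by rw [Fin.lt_def] at hi'; omega) i' rfl
  refine ⟨Finset.ext fun i => hS _ i rfl, Finset.ext fun j => ?_⟩
  by_cases hj0 : j.val = 0
  · exact iff_of_true (h.t0 _ hj0) (h'.t0 _ hj0)
  · obtain ⟨i, hd⟩ := hM.min_col j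
    rw [← h.col i j hd (by tauto), ← h'.col i j hd (by tauto)]
    exact hS _ i rfl

lemma root_below {n : ℕ} (hn : 2 ≤ n) {M : Fin n → Fin n → Bool} (hM : IsC M) :
    ∃ i : Fin n, i.val ≠ 0 ∧ M i ⟨0, by omega⟩ = true := by
  have hr := hM.root (by omega)
  by_contra hcon
  have h1 : ¬ ∃ i' : Fin n, (⟨0, by omega⟩ : Fin n) < i' ∧ M i' ⟨0, by omega⟩ = true := by
    rintro ⟨i, h1, h2⟩
    exact hcon ⟨i, by rw [Fin.lt_def] at h1; simp only at h1; omega, h2⟩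
  have h2 := h1
  rw [hM.complete _ _ hr] at h2
  obtain ⟨j, hj, hj'⟩ := exists_leftmost hM ⟨1, by omega⟩
  obtain ⟨i', hi', hd⟩ := leftmost_above hM hj hj' (by simp)
  have hn0 : 0 < n := by omega
  have : i' = ⟨0, hn0⟩ := by
    apply Fin.ext; rw [Fin.lt_def] at hi'; simp only at hi' ⊢; omega
  subst this
  by_cases hj0 : j.val = 0
  · have : j = ⟨0, hn0⟩ := Fin.ext hj0
    subst this
    exact hcon ⟨⟨1, by omega⟩, by simp, hj⟩
  · exact h2 ⟨j, by rw [Fin.lt_def]; simp only; omega, hd⟩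

lemma valid_card {n : ℕ} (hn : 2 ≤ n) {M : Fin n → Fin n → Bool} (hM : IsC M)
    {S T : Finset (Fin n)} (h : Valid M S T) : S.card = T.card := by
  obtain ⟨i0, hi0, hd0⟩ := root_below hn hM
  apply le_antisymm
  · choose r hr hr' using exists_rightmost hM
    apply Finset.card_le_card_of_injOn r
    · intro i hi
      exact (h.col i (r i) (hr i) (fun hh => h.s0 _ hi hh.1)).1 hi
    · have key : ∀ i i', i < i' → r i ≠ r i' := by
        intro i i' hlt heq
        obtain ⟨j', h1, h2⟩ := (hM.complete i (r i) (hr i)).1 ⟨i', hlt, by rw [heq]; exact hr i'⟩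
        exact absurd (hr' i j' h2) (not_le.2 h1)
      intro i _ i' _ heq
      rcases lt_trichotomy i i' with hh | hh | hh
      · exact absurd heq (key _ _ hh)
      · exact hh
      · exact absurd heq.symm (key _ _ hh)
  · choose r hr hr' using exists_rightmost hM.transpose
    apply Finset.card_le_card_of_injOn r
    · intro j hj
      refine (h.col (r j) j (hr j) (fun hh => ?_)).2 hj
      have hn0 : 0 < n := by omega
      have : j = ⟨0, hn0⟩ := Fin.ext hh.2
      subst this
      have := hr' _ i0 hd0
      rw [Fin.le_def] at this
      omega
    · have key : ∀ i i', i < i' → r i ≠ r i' := by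
        intro i i' hlt heq
        obtain ⟨j', h1, h2⟩ := (hM.complete (r i) i (hr i)).2 ⟨i', hlt, by rw [heq]; exact hr i'⟩
        exact absurd (hr' i j' h2) (not_le.2 h1)
      intro i _ i' _ heq
      rcases lt_trichotomy i i' with hh | hh | hh
      · exact absurd heq (key _ _ hh)
      · exact hh
      · exact absurd heq.symm (key _ _ hh)

lemma exists_monoSum {n k l : ℕ} (hn : k + l = n) (s : Finset (Fin n)) (hs : s.card = k) :
    ∃ e : Fin k ⊕ Fin l ≃ Fin n, MonoSum e ∧ (∀ a, e (Sum.inl a) ∈ s) ∧ (∀ b, e (Sum.inr b) ∉ s) ∧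
      ∑ a, (e (Sum.inl a)).val = ∑ i ∈ s, i.val := by
  have hs' : sᶜ.card = l := by rw [Finset.card_compl, Fintype.card_fin]; omega
  refine ⟨finSumEquivOfFinset hs hs', ⟨?_, ?_⟩, ?_, ?_, ?_⟩
  · simpa using (s.orderEmbOfFin hs).strictMono
  · simpa using (sᶜ.orderEmbOfFin hs').strictMono
  · intro a; simp
  · intro b
    have := sᶜ.orderEmbOfFin_mem hs' b
    rw [finSumEquivOfFinset_inr]
    exact Finset.mem_compl.1 this
  · simp only [finSumEquivOfFinset_inl]
    have : s = Finset.univ.map (s.orderEmbOfFin hs).toEmbedding := by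
      ext x; simp
    conv_rhs => rw [this, Finset.sum_map]
    rfl

def dotDet {n : ℕ} (M : Fin n → Fin n → Bool) : ℤ :=
  Matrix.det (Matrix.of fun i j => if M i j then (1 : ℤ) else 0)

def cnatEquiv (n : ℕ) : CNAT n ≃ {M : Fin n → Fin n → Bool // IsC M} where
  toFun M := ⟨M.dot, ⟨M.root, M.nonambiguous, M.min_row, M.min_col, M.complete⟩⟩
  invFun M := ⟨M.1, M.2.root, M.2.nonambiguous, M.2.min_row, M.2.min_col, M.2.complete⟩
  left_inv _ := rfl
  right_inv _ := rfl

open Classical in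
noncomputable def cntC (n : ℕ) (d : ℤ) : ℕ :=
  (Finset.univ.filter fun M : Fin n → Fin n → Bool => IsC M ∧ dotDet M = d).card

lemma cntC_eq (n : ℕ) (d : ℤ) : Nat.card {M : CNAT n // cnatDet M = d} = cntC n d := by
  classical
  have e : {M : CNAT n // cnatDet M = d} ≃ {M : Fin n → Fin n → Bool // IsC M ∧ dotDet M = d} :=
    { toFun := fun M => ⟨M.1.dot, ((cnatEquiv n) M.1).2, M.2⟩
      invFun := fun M => ⟨(cnatEquiv n).symm ⟨M.1, M.2.1⟩, M.2.2⟩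
      left_inv := fun _ => rfl
      right_inv := fun _ => rfl }
  rw [Nat.card_congr e, Nat.card_eq_fintype_card, Fintype.card_subtype, cntC]

/-- pairs with given product of determinants -/
lemma pair_count (k l : ℕ) (d : ℤ) (hd : d = 1 ∨ d = -1) :
    Nat.card {p : (Fin k → Fin k → Bool) × (Fin l → Fin l → Bool) //
      (IsC p.1 ∧ IsC p.2) ∧ dotDet p.1 * dotDet p.2 = d} =
    cntC k 1 * cntC l d + cntC k (-1) * cntC l (-d) := by
  classical
  rw [Nat.card_eq_fintype_card, Fintype.card_subtype]
  unfold cntC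
  rw [← Finset.card_product, ← Finset.card_product, ← Finset.card_union_of_disjoint]
  · congr 1
    ext ⟨p, q⟩
    simp only [Finset.mem_filter, Finset.mem_univ, true_and, Finset.mem_union, Finset.mem_product]
    have : dotDet p * dotDet q = d ↔ (dotDet p = 1 ∧ dotDet q = d) ∨ (dotDet p = -1 ∧ dotDet q = -d) := by
      rcases hd with rfl | rfl
      · rw [Int.mul_eq_one_iff_eq_one_or_neg_one]
      · rw [Int.mul_eq_neg_one_iff_eq_one_or_neg_one]; simp
    rw [this]; tauto
  · rw [Finset.disjoint_left]
    rintro ⟨p, q⟩ h1 h2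
    simp only [Finset.mem_filter, Finset.mem_univ, true_and, Finset.mem_product] at h1 h2
    have := h1.1.2.symm.trans h2.1.2
    omega

lemma fiber_count {n k l : ℕ} (hn : k + l = n) (hk : 0 < k) (hl : 0 < l) (S T : Finset (Fin n))
    (hS : S.card = k) (hT : T.card = k) (hS0 : ∀ i ∈ S, i.val ≠ 0)
    (hT0 : ∀ j : Fin n, j.val = 0 → j ∈ T) :
    Nat.card {M : Fin n → Fin n → Bool // (IsC M ∧ dotDet M = -1) ∧ Valid M S T} =
    Nat.card {p : (Fin k → Fin k → Bool) × (Fin l → Fin l → Bool) //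
      (IsC p.1 ∧ IsC p.2) ∧ dotDet p.1 * dotDet p.2 =
        (-1) ^ (∑ i ∈ S, i.val + ∑ j ∈ T, j.val + 1)} := by
  obtain ⟨e, he, heS, heS', hes⟩ := exists_monoSum hn S hS
  obtain ⟨f, hf, hfT, hfT', hfs⟩ := exists_monoSum hn T hT
  have e0 : ∀ a, (e (Sum.inl a)).val ≠ 0 := fun a => hS0 _ (heS a)
  have f0 : ∀ a, (f (Sum.inr a)).val ≠ 0 := fun a h => hfT' a (hT0 _ h)
  have hn0 : 0 < n := by omega
  have e1 : ∀ a, (e (Sum.inr a)).val = 0 ↔ a.val = 0 := by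
    obtain ⟨x, hx⟩ := e.surjective ⟨0, hn0⟩
    rcases x with x | x
    · exact absurd (congrArg Fin.val hx) (e0 x)
    have hx0 : (e (Sum.inr x)).val = 0 := congrArg Fin.val hx
    have hxx : x.val = 0 := by
      by_contra hc
      have := he.right (a := ⟨0, hl⟩) (b := x) (by rw [Fin.lt_def]; simp only; omega)
      rw [Fin.lt_def] at this
      simp only at this; omega
    intro a
    constructor
    · intro h
      have := e.injective (Fin.ext (h.trans hx0.symm))
      simp only [Sum.inr.injEq] at this
      rw [this, hxx]
    · intro h
      have : a = x := Fin.ext (h.trans hxx.symm)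
      rw [this, hx0]
  have f1 : ∀ a, (f (Sum.inl a)).val = 0 ↔ a.val = 0 := by
    obtain ⟨x, hx⟩ := f.surjective ⟨0, hn0⟩
    rcases x with x | x
    swap
    · exact absurd (congrArg Fin.val hx) (f0 x)
    have hx0 : (f (Sum.inl x)).val = 0 := congrArg Fin.val hx
    have hxx : x.val = 0 := by
      by_contra hc
      have := hf.left (a := ⟨0, hk⟩) (b := x) (by rw [Fin.lt_def]; simp only; omega)
      rw [Fin.lt_def] at this
      simp only at this; omega
    intro a
    constructor
    · intro h
      have := f.injective (Fin.ext (h.trans hx0.symm))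
      simp only [Sum.inl.injEq] at this
      rw [this, hxx]
    · intro h
      have : a = x := Fin.ext (h.trans hxx.symm)
      rw [this, hx0]
  -- restriction
  have glueOf : ∀ M, IsC M → Valid M S T → Glue e f M
      (fun a b => M (e (Sum.inl a)) (f (Sum.inl b))) (fun a b => M (e (Sum.inr a)) (f (Sum.inr b))) := by
    intro M hM hV
    refine ⟨he, hf, e0, e1, f0, f1, fun _ _ => rfl, fun _ _ => rfl, ?_, ?_⟩
    · intro a b
      by_contra h
      have h' : M (e (Sum.inl a)) (f (Sum.inr b)) = true := by simpa using h
      exact hfT' b ((hV.col _ _ h' (fun hh => e0 a hh.1)).1 (heS a))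
    · intro a b
      rw [← e1, ← f1]
      constructor
      · intro h
        by_contra hc
        exact heS' a ((hV.col _ _ h hc).2 (hfT b))
      · rintro ⟨h1, h2⟩
        have := hM.root hn0
        rw [show e (Sum.inr a) = ⟨0, hn0⟩ from Fin.ext h1,
          show f (Sum.inl b) = ⟨0, hn0⟩ from Fin.ext h2]
        exact this
  have detOf : ∀ M L R, Glue e f M L R → dotDet M =
      (-1) ^ (∑ i ∈ S, i.val + ∑ j ∈ T, j.val) * (dotDet L * dotDet R) := by
    intro M L R g
    unfold dotDet
    rw [det_blocks e f he hf _ (by intro a b; simp [g.lr]), hes, hfs]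
    congr 2
    · congr 1; ext a b; simp [g.ll]
    · congr 1; ext a b; simp [g.rr]
  have detIff : ∀ M L R, Glue e f M L R → (dotDet M = -1 ↔ dotDet L * dotDet R =
      (-1) ^ (∑ i ∈ S, i.val + ∑ j ∈ T, j.val + 1)) := by
    intro M L R g
    rw [detOf M L R g, pow_succ]
    rcases neg_one_pow_eq_or ℤ (∑ i ∈ S, i.val + ∑ j ∈ T, j.val) with h | h <;> rw [h]
    · simp
    · constructor <;> intro h <;> linarith
  let G : (Fin k → Fin k → Bool) → (Fin l → Fin l → Bool) → Fin n → Fin n → Bool := fun L R i j =>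
    match e.symm i, f.symm j with
    | Sum.inl a, Sum.inl b => L a b
    | Sum.inr a, Sum.inr b => R a b
    | Sum.inl _, Sum.inr _ => false
    | Sum.inr a, Sum.inl b => decide (a.val = 0 ∧ b.val = 0)
  have hG : ∀ L R, Glue e f (G L R) L R := by
    intro L R
    refine ⟨he, hf, e0, e1, f0, f1, ?_, ?_, ?_, ?_⟩ <;> intro a b <;> simp [G]
  have hV : ∀ M L R, Glue e f M L R → Valid M S T := by
    intro M L R g
    refine ⟨hS0, hT0, ?_⟩
    intro i j
    obtain ⟨i, rfl⟩ := e.surjective i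
    obtain ⟨j, rfl⟩ := f.surjective j
    rcases i with a | a <;> rcases j with b | b <;> intro hd hr
    · exact iff_of_true (heS a) (hfT b)
    · simp [g.lr] at hd
    · rw [g.rl, ← g.e1, ← g.f1] at hd; exact absurd hd hr
    · exact iff_of_false (heS' a) (hfT' b)
  apply Nat.card_congr
  refine ⟨fun M => ⟨(fun a b => M.1 (e (Sum.inl a)) (f (Sum.inl b)),
      fun a b => M.1 (e (Sum.inr a)) (f (Sum.inr b))), ?_⟩,
    fun p => ⟨G p.1.1 p.1.2, ?_⟩, ?_, ?_⟩
  · have g := glueOf M.1 M.2.1.1 M.2.2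
    exact ⟨⟨g.isC_left hl M.2.1.1, g.isC_right hk M.2.1.1⟩, (detIff _ _ _ g).1 M.2.1.2⟩
  · have g := hG p.1.1 p.1.2
    exact ⟨⟨g.isC hk hl p.2.1.1 p.2.1.2, (detIff _ _ _ g).2 p.2.2⟩, hV _ _ _ g⟩
  · rintro ⟨M, hM, hVM⟩
    have g := glueOf M hM.1 hVM
    have g' := hG (fun a b => M (e (Sum.inl a)) (f (Sum.inl b))) (fun a b => M (e (Sum.inr a)) (f (Sum.inr b)))
    apply Subtype.ext
    funext i j
    obtain ⟨i, rfl⟩ := e.surjective i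
    obtain ⟨j, rfl⟩ := f.surjective j
    simp only
    rcases i with a | a <;> rcases j with b | b
    · rw [g'.ll]
    · rw [g'.lr, g.lr]
    · rw [Bool.eq_iff_iff, g'.rl, g.rl]
    · rw [g'.rr]
  · rintro ⟨⟨L, R⟩, hp⟩
    have g' := hG L R
    apply Subtype.ext
    simp only [g'.ll, g'.rr]

open Classical in
noncomputable def rowSets (n k : ℕ) : Finset (Finset (Fin n)) :=
  Finset.univ.filter fun S => S.card = k ∧ ∀ i ∈ S, i.val ≠ 0

open Classical in
noncomputable def colSets (n k : ℕ) : Finset (Finset (Fin n)) :=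
  Finset.univ.filter fun S => S.card = k ∧ ∀ i : Fin n, i.val = 0 → i ∈ S

open Classical in
lemma rowSets_count (n k : ℕ) (P : ℕ → Prop) :
    ((rowSets n k).filter fun S => P (∑ i ∈ S, i.val)).card =
    ((Finset.powersetCard k (Finset.Icc 1 (n - 1))).filter fun S => P (S.sum id)).card := by
  apply Finset.card_nbij' (fun S => S.map Fin.valEmbedding)
    (fun S => Finset.univ.filter fun i : Fin n => i.val ∈ S)
  · intro S hS
    simp only [rowSets, Finset.coe_filter, Set.mem_ofPred_eq, Finset.mem_filter, Finset.mem_univ, true_and,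
      Finset.mem_powersetCard, Finset.card_map, Finset.sum_map] at hS ⊢
    refine ⟨⟨?_, hS.1.1⟩, hS.2⟩
    intro x hx
    obtain ⟨i, hi, rfl⟩ := Finset.mem_map.1 hx
    have := hS.1.2 i hi
    simp only [Fin.valEmbedding_apply, Finset.mem_Icc]
    omega
  · intro S hS
    simp only [rowSets, Finset.coe_filter, Set.mem_ofPred_eq, Finset.mem_filter, Finset.mem_univ, true_and,
      Finset.mem_powersetCard] at hS ⊢
    have hm : (Finset.univ.filter fun i : Fin n => i.val ∈ S).map Fin.valEmbedding = S := by
      ext x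
      simp only [Finset.mem_map, Finset.mem_filter, Finset.mem_univ, true_and, Fin.valEmbedding_apply]
      constructor
      · rintro ⟨i, hi, rfl⟩; exact hi
      · intro hx
        have := Finset.mem_Icc.1 (hS.1.1 hx)
        exact ⟨⟨x, by omega⟩, hx, rfl⟩
    refine ⟨⟨?_, ?_⟩, ?_⟩
    · rw [← Finset.card_map Fin.valEmbedding, hm, hS.1.2]
    · intro i hi
      have := Finset.mem_Icc.1 (hS.1.1 hi)
      omega
    · have h2 := hS.2
      rw [← hm, Finset.sum_map] at h2
      exact h2
  · intro S hS
    ext i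
    simp [Fin.val_inj]
  · intro S hS
    simp only [Finset.coe_filter, Set.mem_ofPred_eq, Finset.mem_powersetCard] at hS
    ext x
    simp only [Finset.mem_map, Finset.mem_filter, Finset.mem_univ, true_and, Fin.valEmbedding_apply]
    constructor
    · rintro ⟨i, hi, rfl⟩; exact hi
    · intro hx
      have := Finset.mem_Icc.1 (hS.1.1 hx)
      exact ⟨⟨x, by omega⟩, hx, rfl⟩

open Classical in
lemma colSets_count (n k : ℕ) (hn : 0 < n) (hk : 0 < k) (P : ℕ → Prop) :
    ((colSets n k).filter fun S => P (∑ i ∈ S, i.val)).card =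
    ((rowSets n (k - 1)).filter fun S => P (∑ i ∈ S, i.val)).card := by
  apply Finset.card_nbij' (fun S => S.erase ⟨0, hn⟩) (fun S => insert ⟨0, hn⟩ S)
  · intro S hS
    simp only [rowSets, colSets, Finset.coe_filter, Set.mem_ofPred_eq, Finset.mem_filter, Finset.mem_univ, true_and] at hS ⊢
    have h0 := hS.1.2 ⟨0, hn⟩ rfl
    refine ⟨⟨by rw [Finset.card_erase_of_mem h0, hS.1.1], ?_⟩, ?_⟩
    · intro i hi h
      exact Finset.ne_of_mem_erase hi (Fin.ext h)
    · have := Finset.add_sum_erase S (fun i => i.val) h0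
      simp only [zero_add] at this
      rw [this]; exact hS.2
  · intro S hS
    simp only [rowSets, colSets, Finset.coe_filter, Set.mem_ofPred_eq, Finset.mem_filter, Finset.mem_univ, true_and] at hS ⊢
    have h0 : (⟨0, hn⟩ : Fin n) ∉ S := fun h => hS.1.2 _ h rfl
    refine ⟨⟨by rw [Finset.card_insert_of_notMem h0, hS.1.1]; omega, ?_⟩, ?_⟩
    · intro i hi
      rw [show i = ⟨0, hn⟩ from Fin.ext hi]; exact Finset.mem_insert_self _ _
    · rw [Finset.sum_insert h0]
      simpa using hS.2
  · intro S hS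
    simp only [colSets, Finset.coe_filter, Set.mem_ofPred_eq, Finset.mem_filter, Finset.mem_univ, true_and] at hS
    exact Finset.insert_erase (hS.1.2 ⟨0, hn⟩ rfl)
  · intro S hS
    simp only [rowSets, Finset.coe_filter, Set.mem_ofPred_eq, Finset.mem_filter, Finset.mem_univ, true_and] at hS
    exact Finset.erase_insert (fun h => hS.1.2 _ h rfl)

lemma sum_parity {α : Type*} (X : Finset α) (φ : α → ℕ) (F : α → ℕ) (x y : ℕ)
    (h0 : ∀ a ∈ X, Even (φ a) → F a = x) (h1 : ∀ a ∈ X, Odd (φ a) → F a = y) :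
    ∑ a ∈ X, F a = (X.filter fun a => Even (φ a)).card * x + (X.filter fun a => Odd (φ a)).card * y := by
  rw [← Finset.sum_filter_add_sum_filter_not X (fun a => Even (φ a))]
  simp only [Nat.not_even_iff_odd]
  congr 1
  · rw [Finset.sum_const_nat]
    intro a ha; rw [Finset.mem_filter] at ha; exact h0 a ha.1 ha.2
  · rw [Finset.sum_const_nat]
    intro a ha; rw [Finset.mem_filter] at ha; exact h1 a ha.1 ha.2

lemma fiber_total (n k : ℕ) (hk : 1 ≤ k) (hkn : k ≤ n - 1) (hn : 2 ≤ n) :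
    ∑ S ∈ rowSets n k, ∑ T ∈ colSets n k,
      Nat.card {M : Fin n → Fin n → Bool // (IsC M ∧ dotDet M = -1) ∧ Valid M S T} =
    ((cnatA k * cnatB (n - k) + cnatB k * cnatA (n - k)) *
          (eCount (n - 1) (k - 1) * eCount (n - 1) k +
            oCount (n - 1) (k - 1) * oCount (n - 1) k) +
        (cnatA k * cnatA (n - k) + cnatB k * cnatB (n - k)) *
          (eCount (n - 1) (k - 1) * oCount (n - 1) k +
            oCount (n - 1) (k - 1) * eCount (n - 1) k)) := by
  classical
  set w0 := cnatA k * cnatB (n - k) + cnatB k * cnatA (n - k) with hw0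
  set w1 := cnatA k * cnatA (n - k) + cnatB k * cnatB (n - k) with hw1
  have hcol : ∀ P : ℕ → Prop, ((colSets n k).filter fun S => P (∑ i ∈ S, i.val)).card =
      ((Finset.powersetCard (k - 1) (Finset.Icc 1 (n - 1))).filter fun S => P (S.sum id)).card := by
    intro P
    rw [colSets_count n k (by omega) (by omega), rowSets_count]
  have hce : ((colSets n k).filter fun S => Even (∑ i ∈ S, i.val)).card = eCount (n - 1) (k - 1) := by
    rw [eCount]; convert hcol Even
  have hco : ((colSets n k).filter fun S => Odd (∑ i ∈ S, i.val)).card = oCount (n - 1) (k - 1) := by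
    rw [oCount]; convert hcol Odd
  have hre : ((rowSets n k).filter fun S => Even (∑ i ∈ S, i.val)).card = eCount (n - 1) k := by
    rw [eCount]; convert rowSets_count n k Even
  have hro : ((rowSets n k).filter fun S => Odd (∑ i ∈ S, i.val)).card = oCount (n - 1) k := by
    rw [oCount]; convert rowSets_count n k Odd
  have hf : ∀ S ∈ rowSets n k, ∀ T ∈ colSets n k,
      Nat.card {M : Fin n → Fin n → Bool // (IsC M ∧ dotDet M = -1) ∧ Valid M S T} =
      if Even (∑ i ∈ S, i.val + ∑ j ∈ T, j.val) then w0 else w1 := by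
    intro S hS T hT
    simp only [rowSets, colSets, Finset.mem_filter, Finset.mem_univ, true_and] at hS hT
    rw [fiber_count (k := k) (l := n - k) (by omega) (by omega) (by omega) S T hS.1 hT.1 hS.2 hT.2]
    rw [pair_count _ _ _ (neg_one_pow_eq_or ℤ _)]
    simp only [hw0, hw1, cnatA, cnatB, cntC_eq]
    split_ifs with h
    · rw [(Even.add_one h).neg_one_pow]; simp
    · rw [(Odd.add_one (Nat.not_even_iff_odd.1 h)).neg_one_pow]
  rw [Finset.sum_congr rfl (fun S hS => Finset.sum_congr rfl (hf S hS))]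
  rw [sum_parity (rowSets n k) (fun S => ∑ i ∈ S, i.val) _
    (eCount (n - 1) (k - 1) * w0 + oCount (n - 1) (k - 1) * w1)
    (eCount (n - 1) (k - 1) * w1 + oCount (n - 1) (k - 1) * w0), hre, hro]
  · ring
  · intro S _ hS
    rw [sum_parity (colSets n k) (fun S => ∑ i ∈ S, i.val) _ w0 w1, hce, hco]
    · intro T _ hT; rw [if_pos (hS.add hT)]
    · intro T _ hT; rw [if_neg (Nat.not_even_iff_odd.2 (hS.add_odd hT))]
  · intro S _ hS
    rw [sum_parity (colSets n k) (fun S => ∑ i ∈ S, i.val) _ w1 w0, hce, hco]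
    · intro T _ hT; rw [if_neg (Nat.not_even_iff_odd.2 (hS.add_even hT))]
    · intro T _ hT; rw [if_pos (hS.add_odd hT)]

theorem cnat_B_recurrence (n : ℕ) (hn : 2 ≤ n) :
    cnatB n = ∑ k ∈ Finset.Icc 1 (n - 1),
      ((cnatA k * cnatB (n - k) + cnatB k * cnatA (n - k)) *
          (eCount (n - 1) (k - 1) * eCount (n - 1) k +
            oCount (n - 1) (k - 1) * oCount (n - 1) k) +
        (cnatA k * cnatA (n - k) + cnatB k * cnatB (n - k)) *
          (eCount (n - 1) (k - 1) * oCount (n - 1) k +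
            oCount (n - 1) (k - 1) * eCount (n - 1) k)) := by
  classical
  have h1 : ∀ k ∈ Finset.Icc 1 (n - 1), _ = _ := fun k hk =>
    fiber_total n k (Finset.mem_Icc.1 hk).1 (Finset.mem_Icc.1 hk).2 hn
  rw [← Finset.sum_congr rfl h1]
  rw [cnatB, cntC_eq, cntC]
  set X := Finset.univ.filter fun M : Fin n → Fin n → Bool => IsC M ∧ dotDet M = -1 with hX
  set Q : Finset (Σ _ : ℕ, Finset (Fin n) × Finset (Fin n)) :=
    (Finset.Icc 1 (n - 1)).sigma fun k => rowSets n k ×ˢ colSets n k with hQ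
  have h2 := Finset.sum_card_bipartiteAbove_eq_sum_card_bipartiteBelow (s := X) (t := Q)
    (fun M q => Valid M q.2.1 q.2.2)
  have h3 : ∀ M ∈ X, (Q.bipartiteAbove (fun M q => Valid M q.2.1 q.2.2) M).card = 1 := by
    intro M hM
    simp only [hX, Finset.mem_filter, Finset.mem_univ, true_and] at hM
    obtain ⟨S, T, hV⟩ := exists_valid hM.1
    have hc := valid_card hn hM.1 hV
    rw [Finset.card_eq_one]
    refine ⟨⟨S.card, S, T⟩, ?_⟩
    ext ⟨k, S', T'⟩
    simp only [Finset.mem_bipartiteAbove, hQ, Finset.mem_sigma, Finset.mem_product, rowSets, colSets,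
      Finset.mem_filter, Finset.mem_univ, true_and, Finset.mem_singleton, Finset.mem_Icc]
    constructor
    · rintro ⟨⟨_, ⟨h4, _⟩, _⟩, h5⟩
      obtain ⟨rfl, rfl⟩ := valid_unique hM.1 hV h5
      rw [h4]
    · intro h
      simp only [Sigma.mk.injEq, heq_eq_eq, Prod.mk.injEq] at h
      obtain ⟨rfl, rfl, rfl⟩ := h
      refine ⟨⟨⟨?_, ?_⟩, ⟨rfl, hV.s0⟩, hc.symm, hV.t0⟩, hV⟩
      · rw [hc]
        exact Finset.card_pos.2 ⟨⟨0, by omega⟩, hV.t0 _ rfl⟩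
      · have : S' ⊂ Finset.univ := by
          rw [Finset.ssubset_univ_iff]
          intro h
          exact hV.s0 ⟨0, by omega⟩ (by rw [h]; exact Finset.mem_univ _) rfl
        have := Finset.card_lt_card this
        simp at this
        omega
  rw [Finset.sum_congr rfl h3, Finset.sum_const, smul_eq_mul, mul_one] at h2
  rw [h2, hQ, Finset.sum_sigma]
  refine Finset.sum_congr rfl fun k _ => ?_
  rw [Finset.sum_product]
  refine Finset.sum_congr rfl fun S _ => Finset.sum_congr rfl fun T _ => ?_
  rw [Nat.card_eq_fintype_card, Fintype.card_subtype]
  congr 1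
  ext M
  simp [Finset.mem_bipartiteBelow, hX]
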